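/- arXiv:1310.2380 — 2 statements merged into one kernel-verified Lean document; each statement's English description precedes it below -/
import Mathlib

section
/- Let ε>0 and let f: X→Y be a linear operator between Banach spaces satisfying (1−ε)‖x‖ ≤ ‖f(x)‖ ≤ (1+ε)‖x‖ for all x∈X. Then the closed unit ball of X ⊕_{(f,ε)} Y is the closed convex hull of the set (B_X×{0}) ∪ ({0}×B_Y) ∪ {(w, −f(w)) : w∈X, ‖w‖_X ≤ ε^{-1}}, where B_X and B_Y denote the closed unit balls of X and Y. -/
/-- The norm `‖·‖_C` on `X × Y` associated to a map `f : X → Y` and `ε > 0`: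
`‖v‖_C = inf { ‖x‖ + ‖y‖ + ε‖w‖ : v = (x + w, y - f w) }`. -/
noncomputable def normC {X Y : Type*} [NormedAddCommGroup X] [NormedAddCommGroup Y]
    (ε : ℝ) (f : X → Y) (v : X × Y) : ℝ :=
  sInf {r : ℝ | ∃ (x w : X) (y : Y), v = (x + w, y - f w) ∧ r = ‖x‖ + ‖y‖ + ε * ‖w‖}

theorem normC_le_rep {X Y : Type*} [NormedAddCommGroup X] [NormedAddCommGroup Y]
    {ε : ℝ} (hε : 0 < ε) (f : X → Y) (v : X × Y) (x w : X) (y : Y)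
    (h : v = (x + w, y - f w)) : normC ε f v ≤ ‖x‖ + ‖y‖ + ε * ‖w‖ := by
  refine csInf_le ⟨0, ?_⟩ ⟨x, w, y, h, rfl⟩
  rintro r ⟨x, w, y, -, rfl⟩
  positivity

theorem exists_rep_of_normC_lt {X Y : Type*} [NormedAddCommGroup X] [NormedAddCommGroup Y]
    {ε : ℝ} (f : X → Y) (v : X × Y) {t : ℝ} (h : normC ε f v < t) :
    ∃ (x w : X) (y : Y), v = (x + w, y - f w) ∧ ‖x‖ + ‖y‖ + ε * ‖w‖ < t := by
  have hne : {r : ℝ | ∃ (x w : X) (y : Y), v = (x + w, y - f w) ∧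
      r = ‖x‖ + ‖y‖ + ε * ‖w‖}.Nonempty :=
    ⟨_, v.1, 0, v.2 + f 0, by simp, rfl⟩
  obtain ⟨r, ⟨x, w, y, hv, rfl⟩, hr⟩ := exists_lt_of_csInf_lt hne h
  exact ⟨x, w, y, hv, hr⟩

theorem smul_inv_aux {E : Type*} [AddCommGroup E] [Module ℝ E] (a t : ℝ) (x : E)
    (h : a = 0 → x = 0) : (a / t) • (a⁻¹ • x) = t⁻¹ • x := by
  by_cases ha : a = 0
  · simp [h ha]
  · rw [smul_smul]
    congr 1
    field_simp

/-- The closed unit ball of `X ⊕_{(f,ε)} Y` is the closed convex hull of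
`(B_X × {0}) ∪ ({0} × B_Y) ∪ {(w, -f w) : ‖w‖ ≤ ε⁻¹}`. -/
theorem normC_unit_ball_eq_closed_convex_hull
    {X Y : Type*} [NormedAddCommGroup X] [NormedSpace ℝ X] [CompleteSpace X]
    [NormedAddCommGroup Y] [NormedSpace ℝ Y] [CompleteSpace Y]
    (ε : ℝ) (hε : 0 < ε) (f : X →ₗ[ℝ] Y)
    (hf : ∀ x : X, (1 - ε) * ‖x‖ ≤ ‖f x‖ ∧ ‖f x‖ ≤ (1 + ε) * ‖x‖) :
    {v : X × Y | normC ε f v ≤ 1} =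
      closure (convexHull ℝ
        ((Metric.closedBall (0 : X) 1 ×ˢ ({0} : Set Y)) ∪
         (({0} : Set X) ×ˢ Metric.closedBall (0 : Y) 1) ∪
         {p : X × Y | ∃ w : X, ‖w‖ ≤ ε⁻¹ ∧ p = (w, -f w)})) := by
  set S : Set (X × Y) := ((Metric.closedBall (0 : X) 1 ×ˢ ({0} : Set Y)) ∪
         (({0} : Set X) ×ˢ Metric.closedBall (0 : Y) 1) ∪
         {p : X × Y | ∃ w : X, ‖w‖ ≤ ε⁻¹ ∧ p = (w, -f w)}) with hS
  apply Set.Subset.antisymm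
  · intro v hv
    have hv' : normC ε f v ≤ 1 := hv
    have key : ∀ t : ℝ, 1 < t → t⁻¹ • v ∈ convexHull ℝ S := by
      intro t ht
      obtain ⟨x, w, y, hvr, hs⟩ := exists_rep_of_normC_lt f v (lt_of_le_of_lt hv' ht)
      have ht0 : 0 < t := by linarith
      have hC := convex_convexHull ℝ S
      have m1 : ((‖x‖⁻¹ • x, 0) : X × Y) ∈ S := by
        refine Or.inl (Or.inl ⟨?_, rfl⟩)
        simp only [mem_closedBall_zero_iff, norm_smul, norm_inv, norm_norm]
        exact inv_mul_le_one
      have m2 : ((0, ‖y‖⁻¹ • y) : X × Y) ∈ S := by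
        refine Or.inl (Or.inr ⟨rfl, ?_⟩)
        simp only [mem_closedBall_zero_iff, norm_smul, norm_inv, norm_norm]
        exact inv_mul_le_one
      have m3 : (((ε * ‖w‖)⁻¹ • w, -f ((ε * ‖w‖)⁻¹ • w)) : X × Y) ∈ S := by
        refine Or.inr ⟨_, ?_, rfl⟩
        rw [norm_smul, norm_inv, norm_mul, norm_norm, Real.norm_of_nonneg hε.le, mul_inv, mul_assoc]
        exact mul_le_of_le_one_right (by positivity) inv_mul_le_one
      have m0 : (0 : X × Y) ∈ S := by
        refine Or.inl (Or.inl ⟨?_, rfl⟩)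
        simp
      have hm := hC.sum_mem (t := Finset.univ)
        (w := ![‖x‖ / t, ‖y‖ / t, (ε * ‖w‖) / t, 1 - (‖x‖ + ‖y‖ + ε * ‖w‖) / t])
        (z := ![(‖x‖⁻¹ • x, 0), (0, ‖y‖⁻¹ • y),
          ((ε * ‖w‖)⁻¹ • w, -f ((ε * ‖w‖)⁻¹ • w)), 0])
        (by
          have h4 : 0 ≤ 1 - (‖x‖ + ‖y‖ + ε * ‖w‖) / t := by
            rw [sub_nonneg, div_le_one ht0]; exact hs.le
          intro i _
          fin_cases i
          · show 0 ≤ ‖x‖ / t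
            positivity
          · show 0 ≤ ‖y‖ / t
            positivity
          · show 0 ≤ ε * ‖w‖ / t
            positivity
          · exact h4)
        (by simp [Fin.sum_univ_four]; ring)
        (by
          intro i _
          apply subset_convexHull
          fin_cases i
          · exact m1
          · exact m2
          · exact m3
          · exact m0)
      convert hm using 1
      have e1 := smul_inv_aux ‖x‖ t x (by simp)
      have e2 := smul_inv_aux ‖y‖ t y (by simp)
      have e3 := smul_inv_aux (ε * ‖w‖) t w (by simp [hε.ne'])
      have e4 : (ε * ‖w‖ / t) • f ((ε * ‖w‖)⁻¹ • w) = t⁻¹ • f w := by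
        rw [← map_smul, e3, map_smul]
      rw [Fin.sum_univ_four, hvr]
      show _ = (‖x‖ / t) • ((‖x‖⁻¹ • x, 0) : X × Y) + (‖y‖ / t) • ((0, ‖y‖⁻¹ • y) : X × Y)
        + (ε * ‖w‖ / t) • (((ε * ‖w‖)⁻¹ • w, -f ((ε * ‖w‖)⁻¹ • w)) : X × Y)
        + (1 - (‖x‖ + ‖y‖ + ε * ‖w‖) / t) • (0 : X × Y)
      simp only [Prod.smul_mk, smul_zero, smul_neg, e1, e2, e3, e4, Prod.mk_add_mk, add_zero,
        zero_add, smul_add, smul_sub, sub_eq_add_neg]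
    have hlim : Filter.Tendsto (fun t : ℝ => t⁻¹ • v) (nhdsWithin 1 (Set.Ioi 1)) (nhds v) := by
      have h1 : ContinuousAt (fun t : ℝ => t⁻¹ • v) 1 :=
        (continuousAt_inv₀ one_ne_zero).smul continuousAt_const
      have h2 := h1.tendsto
      simp only [inv_one, one_smul] at h2
      exact h2.mono_left nhdsWithin_le_nhds
    refine mem_closure_of_tendsto hlim ?_
    filter_upwards [self_mem_nhdsWithin] with t ht using key t ht
  · apply closure_minimal
    · apply convexHull_min
      · rintro p ((⟨h1, h2⟩ | ⟨h1, h2⟩) | ⟨w, hw, rfl⟩)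
        · have h2' : p.2 = 0 := h2
          have := normC_le_rep hε f p p.1 0 0 (by ext <;> simp [h2'])
          simp at this h1
          exact this.trans h1
        · have h1' : p.1 = 0 := h1
          have := normC_le_rep hε f p 0 0 p.2 (by ext <;> simp [h1'])
          simp at this h2
          exact this.trans h2
        · have := normC_le_rep hε f (w, -f w) 0 w 0 (by simp)
          simp only [norm_zero, zero_add] at this
          refine this.trans ?_
          calc ε * ‖w‖ ≤ ε * ε⁻¹ := by gcongr
            _ = 1 := mul_inv_cancel₀ hε.ne'
      · intro u hu v hv a b ha hb hab
        rw [Set.mem_setOf_eq]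
        refine le_of_forall_gt_imp_ge_of_dense fun t ht => ?_
        obtain ⟨x, w, y, rfl, h1⟩ := exists_rep_of_normC_lt f u (lt_of_le_of_lt hu ht)
        obtain ⟨x', w', y', rfl, h2⟩ := exists_rep_of_normC_lt f v (lt_of_le_of_lt hv ht)
        have := normC_le_rep hε f (a • (x + w, y - f w) + b • (x' + w', y' - f w'))
          (a • x + b • x') (a • w + b • w') (a • y + b • y') (by
            ext
            · simp only [Prod.smul_mk, Prod.mk_add_mk, smul_add]; abel
            · simp only [Prod.smul_mk, Prod.mk_add_mk, smul_sub, map_add, map_smul]; abel)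
        have n : ∀ {E : Type _} [NormedAddCommGroup E] [NormedSpace ℝ E] (p q : E),
            ‖a • p + b • q‖ ≤ a * ‖p‖ + b * ‖q‖ := by
          intro E _ _ p q
          refine (norm_add_le _ _).trans ?_
          rw [norm_smul, norm_smul, Real.norm_of_nonneg ha, Real.norm_of_nonneg hb]
        have ny : ‖a • y + b • y'‖ ≤ a * ‖y‖ + b * ‖y'‖ := by
          refine (norm_add_le _ _).trans ?_
          rw [norm_smul, norm_smul, Real.norm_of_nonneg ha, Real.norm_of_nonneg hb]
        have nx := n x x'
        have nw := mul_le_mul_of_nonneg_left (n w w') hε.le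
        have k1 := mul_le_mul_of_nonneg_left h1.le ha
        have k2 := mul_le_mul_of_nonneg_left h2.le hb
        have k3 : a * t + b * t = t := by rw [← add_mul, hab, one_mul]
        linarith
    · rw [← isSeqClosed_iff_isClosed]
      intro u v hu hlim
      rw [Set.mem_setOf_eq]
      refine le_of_forall_gt_imp_ge_of_dense fun t ht => ?_
      have hd : Filter.Tendsto (fun n => ‖v.1 - (u n).1‖ + ‖v.2 - (u n).2‖) Filter.atTop
          (nhds 0) := by
        have hc : Continuous (fun p : X × Y => ‖v.1 - p.1‖ + ‖v.2 - p.2‖) := by fun_prop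
        have := (hc.tendsto v).comp hlim
        simpa [Function.comp_def] using this
      obtain ⟨n, hn⟩ := (hd.eventually_lt_const (show 0 < (t - 1) / 2 by linarith)).exists
      have hun : normC ε f (u n) ≤ 1 := hu n
      obtain ⟨x, w, y, he, h1⟩ := exists_rep_of_normC_lt f (u n)
        (lt_of_le_of_lt hun (show 1 < 1 + (t - 1) / 2 by linarith))
      have := normC_le_rep hε f v (x + (v.1 - (u n).1)) w (y + (v.2 - (u n).2)) (by
        rw [he]
        ext
        · simp only; abel
        · simp only; abel)
      have a1 := norm_add_le x (v.1 - (u n).1)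
      have a2 := norm_add_le y (v.2 - (u n).2)
      linarith
end

section
/- Let Ω: U→V be a nonexpansive linear operator between separable Banach spaces with the Gurarii property. Then for every nonexpansive linear operator T: X→Y between separable Banach spaces there exist linear isometric embeddings i: X→U and j: Y→V such that Ω∘i = j∘T. -/
/-- `f` is an `ε`-isometric embedding: `(1+ε)⁻¹‖x‖ ≤ ‖f x‖ ≤ ‖x‖`. -/
def IsEpsIsometry {X Y : Type*} [NormedAddCommGroup X] [NormedAddCommGroup Y]
    (ε : ℝ) (f : X → Y) : Prop :=
  ∀ x : X, (1 + ε)⁻¹ * ‖x‖ ≤ ‖f x‖ ∧ ‖f x‖ ≤ ‖x‖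

/-- Condition (G): the Gurarii property of an operator `Ω : U → V`. -/
def HasGurariiProperty {U V : Type*} [NormedAddCommGroup U] [NormedSpace ℝ U]
    [NormedAddCommGroup V] [NormedSpace ℝ V] (Ω : U →L[ℝ] V) : Prop :=
  ∀ (ε : ℝ), 0 < ε →
    ∀ (X Y : Type) [NormedAddCommGroup X] [NormedSpace ℝ X] [FiniteDimensional ℝ X]
      [NormedAddCommGroup Y] [NormedSpace ℝ Y] [FiniteDimensional ℝ Y]
      (X₀ : Submodule ℝ X) (Y₀ : Submodule ℝ Y) (T : X →L[ℝ] Y),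
      ‖T‖ ≤ 1 →
      ∀ (hT : ∀ x ∈ X₀, T x ∈ Y₀) (i : X₀ →ₗᵢ[ℝ] U) (j : Y₀ →ₗᵢ[ℝ] V),
        (∀ x : X₀, Ω (i x) = j ⟨T x, hT x x.2⟩) →
        ∃ (i' : X →L[ℝ] U) (j' : Y →L[ℝ] V),
          IsEpsIsometry ε i' ∧ IsEpsIsometry ε j' ∧
          ‖i'.comp X₀.subtypeL - i.toContinuousLinearMap‖ < ε ∧
          ‖j'.comp Y₀.subtypeL - j.toContinuousLinearMap‖ < ε ∧
          ‖Ω.comp i' - j'.comp T‖ < ε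

/-- Condition (G*): as (G) but with exact commutation `Ω ∘ i' = j' ∘ T`. -/
def HasGurariiStarProperty {U V : Type*} [NormedAddCommGroup U] [NormedSpace ℝ U]
    [NormedAddCommGroup V] [NormedSpace ℝ V] (Ω : U →L[ℝ] V) : Prop :=
  ∀ (ε : ℝ), 0 < ε →
    ∀ (X Y : Type) [NormedAddCommGroup X] [NormedSpace ℝ X] [FiniteDimensional ℝ X]
      [NormedAddCommGroup Y] [NormedSpace ℝ Y] [FiniteDimensional ℝ Y]
      (X₀ : Submodule ℝ X) (Y₀ : Submodule ℝ Y) (T : X →L[ℝ] Y),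
      ‖T‖ ≤ 1 →
      ∀ (hT : ∀ x ∈ X₀, T x ∈ Y₀) (i : X₀ →ₗᵢ[ℝ] U) (j : Y₀ →ₗᵢ[ℝ] V),
        (∀ x : X₀, Ω (i x) = j ⟨T x, hT x x.2⟩) →
        ∃ (i' : X →L[ℝ] U) (j' : Y →L[ℝ] V),
          IsEpsIsometry ε i' ∧ IsEpsIsometry ε j' ∧
          ‖i'.comp X₀.subtypeL - i.toContinuousLinearMap‖ < ε ∧
          ‖j'.comp Y₀.subtypeL - j.toContinuousLinearMap‖ < ε ∧
          Ω.comp i' = j'.comp T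

/-- Condition (g): the defining extension property of the Gurarii space. -/
def SatisfiesConditionSmallG (W : Type*) [NormedAddCommGroup W] [NormedSpace ℝ W] : Prop :=
  ∀ (ε : ℝ), 0 < ε →
    ∀ (X : Type) [NormedAddCommGroup X] [NormedSpace ℝ X] [FiniteDimensional ℝ X]
      (X₀ : Submodule ℝ X) (i : X₀ →ₗᵢ[ℝ] W),
      ∃ f : X →L[ℝ] W, IsEpsIsometry ε f ∧
        ‖f.comp X₀.subtypeL - i.toContinuousLinearMap‖ ≤ ε

open Filter Topology

lemma exists_copy {E : Type*} [AddCommGroup E] [Module ℝ E] [FiniteDimensional ℝ E]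
    (p : Seminorm ℝ E) (hp : ∀ x, p x = 0 → x = 0) :
    ∃ (X : Type) (_ : NormedAddCommGroup X) (_ : NormedSpace ℝ X) (_ : FiniteDimensional ℝ X)
      (e : E ≃ₗ[ℝ] X), ∀ x, ‖e x‖ = p x := by
  classical
  let e : E ≃ₗ[ℝ] (Fin (Module.finrank ℝ E) →₀ ℝ) := (Module.finBasis ℝ E).repr
  let nX : Norm (Fin (Module.finrank ℝ E) →₀ ℝ) := ⟨fun x => p (e.symm x)⟩
  have core : NormedSpace.Core ℝ (Fin (Module.finrank ℝ E) →₀ ℝ) :=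
    { norm_nonneg := fun x => apply_nonneg p _
      norm_smul := fun c x => by
        change p (e.symm (c • x)) = ‖c‖ * p (e.symm x)
        rw [map_smul, map_smul_eq_mul]
      norm_triangle := fun x y => by
        change p (e.symm (x + y)) ≤ p (e.symm x) + p (e.symm y)
        rw [map_add]; exact map_add_le_add p _ _
      norm_eq_zero_iff := fun x => by
        change p (e.symm x) = 0 ↔ x = 0
        constructor
        · intro h
          exact e.symm.map_eq_zero_iff.mp (hp _ h)
        · rintro rfl
          simp }
  let i1 : NormedAddCommGroup (Fin (Module.finrank ℝ E) →₀ ℝ) := NormedAddCommGroup.ofCore core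
  let i2 : NormedSpace ℝ (Fin (Module.finrank ℝ E) →₀ ℝ) := NormedSpace.ofCore core
  refine ⟨_, i1, i2, ?_, e, fun x => ?_⟩
  · exact Module.Finite.equiv e
  · change p (e.symm (e x)) = p x
    simp

section
variable {U V : Type*} [NormedAddCommGroup U] [NormedSpace ℝ U]
    [NormedAddCommGroup V] [NormedSpace ℝ V]

lemma gurarii_transport (Ω : U →L[ℝ] V) (hG : HasGurariiProperty Ω)
    {E F : Type*} [AddCommGroup E] [Module ℝ E] [FiniteDimensional ℝ E]
    [AddCommGroup F] [Module ℝ F] [FiniteDimensional ℝ F]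
    (p : Seminorm ℝ E) (hp : ∀ x, p x = 0 → x = 0)
    (q : Seminorm ℝ F) (hq : ∀ x, q x = 0 → x = 0)
    (T : E →ₗ[ℝ] F) (hT : ∀ x, q (T x) ≤ p x)
    (E₀ : Submodule ℝ E) (F₀ : Submodule ℝ F) (hT0 : ∀ x ∈ E₀, T x ∈ F₀)
    (i : E →ₗ[ℝ] U) (j : F →ₗ[ℝ] V)
    (hi : ∀ x ∈ E₀, ‖i x‖ = p x) (hj : ∀ x ∈ F₀, ‖j x‖ = q x)
    (hc : ∀ x ∈ E₀, Ω (i x) = j (T x)) (ε : ℝ) (hε : 0 < ε) :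
    ∃ (i' : E →ₗ[ℝ] U) (j' : F →ₗ[ℝ] V),
      (∀ x, (1 + ε)⁻¹ * p x ≤ ‖i' x‖ ∧ ‖i' x‖ ≤ p x) ∧
      (∀ x, (1 + ε)⁻¹ * q x ≤ ‖j' x‖ ∧ ‖j' x‖ ≤ q x) ∧
      (∀ x ∈ E₀, ‖i' x - i x‖ ≤ ε * p x) ∧
      (∀ x ∈ F₀, ‖j' x - j x‖ ≤ ε * q x) ∧
      (∀ x, ‖Ω (i' x) - j' (T x)‖ ≤ ε * p x) := by
  obtain ⟨X, _, _, _, e, he⟩ := exists_copy p hp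
  obtain ⟨Y, _, _, _, d, hd⟩ := exists_copy q hq
  have he' : ∀ x, p (e.symm x) = ‖x‖ := fun x => by rw [← he]; simp
  have hd' : ∀ x, q (d.symm x) = ‖x‖ := fun x => by rw [← hd]; simp
  let T' : X →L[ℝ] Y := LinearMap.toContinuousLinearMap (d.toLinearMap ∘ₗ T ∘ₗ e.symm.toLinearMap)
  have hT'e : ∀ x, T' x = d (T (e.symm x)) := fun x => rfl
  let X₀ : Submodule ℝ X := E₀.comap e.symm.toLinearMap
  let Y₀ : Submodule ℝ Y := F₀.comap d.symm.toLinearMap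
  have hX₀ : ∀ x, x ∈ X₀ ↔ e.symm x ∈ E₀ := fun x => Iff.rfl
  have hY₀ : ∀ x, x ∈ Y₀ ↔ d.symm x ∈ F₀ := fun x => Iff.rfl
  have hT' : ‖T'‖ ≤ 1 := by
    refine ContinuousLinearMap.opNorm_le_bound _ zero_le_one fun x => ?_
    rw [hT'e, hd, one_mul, ← he']
    exact hT _
  have hTm : ∀ x ∈ X₀, T' x ∈ Y₀ := by
    intro x hx
    rw [hY₀, hT'e]
    simpa using hT0 _ hx
  let i1 : X₀ →ₗᵢ[ℝ] U := ⟨i ∘ₗ e.symm.toLinearMap ∘ₗ X₀.subtype, fun x => by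
    change ‖i (e.symm x)‖ = ‖(x : X)‖
    rw [hi (e.symm x) x.2]; exact he' _⟩
  let j1 : Y₀ →ₗᵢ[ℝ] V := ⟨j ∘ₗ d.symm.toLinearMap ∘ₗ Y₀.subtype, fun x => by
    change ‖j (d.symm x)‖ = ‖(x : Y)‖
    rw [hj (d.symm x) x.2]; exact hd' _⟩
  obtain ⟨i', j', h1, h2, h3, h4, h5⟩ := hG ε hε X Y X₀ Y₀ T' hT' hTm i1 j1 (by
    intro x
    change Ω (i (e.symm x)) = j (d.symm (T' x))
    rw [hc (e.symm x) x.2, hT'e]; simp)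
  refine ⟨i'.toLinearMap ∘ₗ e.toLinearMap, j'.toLinearMap ∘ₗ d.toLinearMap, ?_, ?_, ?_, ?_, ?_⟩
  · intro x
    have := h1 (e x)
    rw [he] at this
    exact this
  · intro x
    have := h2 (d x)
    rw [hd] at this
    exact this
  · intro x hx
    have hx' : e x ∈ X₀ := by rw [hX₀]; simpa using hx
    have := ContinuousLinearMap.le_of_opNorm_le _ h3.le ⟨e x, hx'⟩
    change ‖i' (e x) - i (e.symm (e x))‖ ≤ ε * ‖e x‖ at this
    rw [he, e.symm_apply_apply] at this
    exact this
  · intro x hx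
    have hx' : d x ∈ Y₀ := by rw [hY₀]; simpa using hx
    have := ContinuousLinearMap.le_of_opNorm_le _ h4.le ⟨d x, hx'⟩
    change ‖j' (d x) - j (d.symm (d x))‖ ≤ ε * ‖d x‖ at this
    rw [hd, d.symm_apply_apply] at this
    exact this
  · intro x
    have := ContinuousLinearMap.le_of_opNorm_le _ h5.le (e x)
    change ‖Ω (i' (e x)) - j' (d (T (e.symm (e x))))‖ ≤ ε * ‖e x‖ at this
    rw [he, e.symm_apply_apply] at this
    exact this

/-- amalgamation seminorm -/
lemma exists_amalgam (f : U →ₗ[ℝ] V) (W : Submodule ℝ U) (ε : ℝ) (hε : 0 < ε) (hε1 : ε ≤ 1)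
    (hf : ∀ w ∈ W, (1 - ε) * ‖w‖ ≤ ‖f w‖ ∧ ‖f w‖ ≤ ‖w‖) :
    ∃ p : Seminorm ℝ (V × U), (∀ x, p x = 0 → x = 0) ∧
      (∀ a, p (a, 0) = ‖a‖) ∧ (∀ x, p (0, x) = ‖x‖) ∧
      (∀ a x, ∀ w ∈ W, p (a, x) ≤ ‖a - f w‖ + ‖x + w‖ + ε * ‖w‖) ∧
      (∀ a x r, (∀ w ∈ W, r ≤ ‖a - f w‖ + ‖x + w‖ + ε * ‖w‖) → r ≤ p (a, x)) := by
  let P : V × U → W → ℝ := fun z w => ‖z.1 - f w‖ + ‖z.2 + w‖ + ε * ‖(w : U)‖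
  have hP0 : ∀ z w, 0 ≤ P z w := fun z w => by positivity
  have hbdd : ∀ z, BddBelow (Set.range (P z)) := fun z => ⟨0, by rintro _ ⟨w, rfl⟩; exact hP0 z w⟩
  let N : V × U → ℝ := fun z => ⨅ w, P z w
  have hle : ∀ z w, N z ≤ P z w := fun z w => ciInf_le (hbdd z) w
  have hge : ∀ z r, (∀ w, r ≤ P z w) → r ≤ N z := fun z r h => le_ciInf h
  have hN0 : ∀ z, 0 ≤ N z := fun z => hge z 0 (hP0 z)
  let p : Seminorm ℝ (V × U) := Seminorm.ofSMulLE N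
    (by
      refine le_antisymm ?_ (hN0 _)
      refine (hle 0 0).trans ?_
      simp [P])
    (by
      intro z z'
      have key : ∀ w w', N (z + z') ≤ P z w + P z' w' := by
        intro w w'
        refine (hle _ (w + w')).trans ?_
        simp only [P, Prod.fst_add, Prod.snd_add, Submodule.coe_add, map_add]
        have e1 : z.1 + z'.1 - (f w + f w') = (z.1 - f w) + (z'.1 - f w') := by abel
        have e2 : z.2 + z'.2 + ((w : U) + w') = (z.2 + w) + (z'.2 + w') := by abel
        rw [e1, e2]
        have := norm_add_le (z.1 - f w) (z'.1 - f w')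
        have := norm_add_le (z.2 + (w : U)) (z'.2 + w')
        have := mul_le_mul_of_nonneg_left (norm_add_le (w : U) w') hε.le
        linarith
      have k2 : ∀ w, N (z + z') - P z w ≤ N z' := fun w => hge _ _ fun w' => by
        linarith [key w w']
      have : N (z + z') - N z' ≤ N z := hge _ _ fun w => by linarith [k2 w]
      linarith)
    (by
      intro c z
      rcases eq_or_ne c 0 with rfl | hc
      · refine (hle _ 0).trans ?_
        simp [P]
      have hc' : 0 < ‖c‖ := norm_pos_iff.mpr hc
      rw [← div_le_iff₀' hc']
      refine hge _ _ fun w => ?_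
      rw [div_le_iff₀' hc']
      refine (hle _ (c • w)).trans (le_of_eq ?_)
      simp only [P, Prod.smul_fst, Prod.smul_snd, Submodule.coe_smul, map_smul, ← smul_sub,
        ← smul_add, norm_smul]
      ring)
  have hpN : ∀ z, p z = N z := fun z => rfl
  refine ⟨p, ?_, ?_, ?_, ?_, ?_⟩
  · rintro ⟨a, x⟩ h
    rw [hpN] at h
    have h1 : ε / 2 * (‖a‖ + ‖x‖) ≤ N (a, x) := by
      refine hge _ _ fun w => ?_
      simp only [P]
      have h1 := (hf w w.2).2
      have h2 : ‖a‖ ≤ ‖a - f w‖ + ‖f w‖ := by simpa using norm_add_le (a - f w) (f w)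
      have h3 : ‖x‖ ≤ ‖x + w‖ + ‖(w : U)‖ := by simpa using norm_sub_le (x + w) (w : U)
      have h4 := norm_nonneg (a - f w)
      have h5 := norm_nonneg (x + (w : U))
      nlinarith
    rw [h] at h1
    have h2 : ‖a‖ + ‖x‖ ≤ 0 := by
      by_contra hh
      push Not at hh
      have : 0 < ε / 2 * (‖a‖ + ‖x‖) := by positivity
      linarith
    have h3 := norm_nonneg a
    have h4 := norm_nonneg x
    have h5 : ‖a‖ = 0 := by linarith
    have h6 : ‖x‖ = 0 := by linarith
    rw [norm_eq_zero] at h5 h6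
    simp [h5, h6]
  · intro a
    rw [hpN]
    refine le_antisymm ((hle _ 0).trans (by simp [P])) (hge _ _ fun w => ?_)
    simp only [P]
    have h1 := (hf w w.2).2
    have h2 : ‖a‖ ≤ ‖a - f w‖ + ‖f w‖ := by simpa using norm_add_le (a - f w) (f w)
    have h3 : 0 ≤ ε * ‖(w : U)‖ := by positivity
    rw [zero_add]
    linarith
  · intro x
    rw [hpN]
    refine le_antisymm ((hle _ 0).trans (by simp [P])) (hge _ _ fun w => ?_)
    simp only [P]
    have h1 := (hf w w.2).1
    have h3 : ‖x‖ ≤ ‖x + w‖ + ‖(w : U)‖ := by simpa using norm_sub_le (x + w) (w : U)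
    rw [zero_sub, norm_neg]
    linarith
  · intro a x w hw
    exact hle (a, x) ⟨w, hw⟩
  · intro a x r h
    exact hge _ _ fun w => h w w.2

lemma gurarii_sub (Ω : U →L[ℝ] V) (hG : HasGurariiProperty Ω)
    {E F : Type*} [AddCommGroup E] [Module ℝ E]
    [AddCommGroup F] [Module ℝ F]
    (p : Seminorm ℝ E) (hp : ∀ x, p x = 0 → x = 0)
    (q : Seminorm ℝ F) (hq : ∀ x, q x = 0 → x = 0)
    (T : E →ₗ[ℝ] F) (hT : ∀ x, q (T x) ≤ p x)
    (E₁ : Submodule ℝ E) (F₁ : Submodule ℝ F) [FiniteDimensional ℝ E₁] [FiniteDimensional ℝ F₁]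
    (hT1 : ∀ x ∈ E₁, T x ∈ F₁)
    (E₀ : Submodule ℝ E) (F₀ : Submodule ℝ F) (hT0 : ∀ x ∈ E₀, T x ∈ F₀)
    (hE : E₀ ≤ E₁) (hF : F₀ ≤ F₁)
    (i : E →ₗ[ℝ] U) (j : F →ₗ[ℝ] V)
    (hi : ∀ x ∈ E₀, ‖i x‖ = p x) (hj : ∀ x ∈ F₀, ‖j x‖ = q x)
    (hc : ∀ x ∈ E₀, Ω (i x) = j (T x)) (ε : ℝ) (hε : 0 < ε) :
    ∃ (i' : E →ₗ[ℝ] U) (j' : F →ₗ[ℝ] V),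
      (∀ x ∈ E₁, (1 + ε)⁻¹ * p x ≤ ‖i' x‖ ∧ ‖i' x‖ ≤ p x) ∧
      (∀ x ∈ F₁, (1 + ε)⁻¹ * q x ≤ ‖j' x‖ ∧ ‖j' x‖ ≤ q x) ∧
      (∀ x ∈ E₀, ‖i' x - i x‖ ≤ ε * p x) ∧
      (∀ x ∈ F₀, ‖j' x - j x‖ ≤ ε * q x) ∧
      (∀ x ∈ E₁, ‖Ω (i' x) - j' (T x)‖ ≤ ε * p x) := by
  obtain ⟨i', j', h1, h2, h3, h4, h5⟩ := gurarii_transport Ω hG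
    (p.comp E₁.subtype) (fun x hx => Subtype.ext (hp _ hx))
    (q.comp F₁.subtype) (fun x hx => Subtype.ext (hq _ hx))
    (T.restrict hT1) (fun x => hT _) (E₀.comap E₁.subtype) (F₀.comap F₁.subtype)
    (fun x hx => hT0 _ hx) (i ∘ₗ E₁.subtype) (j ∘ₗ F₁.subtype)
    (fun x hx => hi _ hx) (fun x hx => hj _ hx) (fun x hx => hc _ hx) ε hε
  obtain ⟨I, hI⟩ := LinearMap.exists_extend i'
  obtain ⟨J, hJ⟩ := LinearMap.exists_extend j'
  have hI' : ∀ x (hx : x ∈ E₁), I x = i' ⟨x, hx⟩ := fun x hx => by rw [← hI]; rfl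
  have hJ' : ∀ x (hx : x ∈ F₁), J x = j' ⟨x, hx⟩ := fun x hx => by rw [← hJ]; rfl
  refine ⟨I, J, ?_, ?_, ?_, ?_, ?_⟩
  · intro x hx
    rw [hI' x hx]; exact h1 ⟨x, hx⟩
  · intro x hx
    rw [hJ' x hx]; exact h2 ⟨x, hx⟩
  · intro x hx
    rw [hI' x (hE hx)]; exact h3 ⟨x, hE hx⟩ hx
  · intro x hx
    rw [hJ' x (hF hx)]; exact h4 ⟨x, hF hx⟩ hx
  · intro x hx
    rw [hI' x hx, hJ' _ (hT1 x hx)]; exact h5 ⟨x, hx⟩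

variable {X Y : Type*} [NormedAddCommGroup X] [NormedSpace ℝ X]
    [NormedAddCommGroup Y] [NormedSpace ℝ Y]

/-- approximate intertwining pair on the given subspaces -/
def IsApprox (Ω : U →L[ℝ] V) (T : X →L[ℝ] Y) (X₁ : Submodule ℝ X) (Y₁ : Submodule ℝ Y) (ε : ℝ)
    (fg : (X →ₗ[ℝ] U) × (Y →ₗ[ℝ] V)) : Prop :=
  (∀ x ∈ X₁, (1 + ε)⁻¹ * ‖x‖ ≤ ‖fg.1 x‖ ∧ ‖fg.1 x‖ ≤ ‖x‖) ∧
  (∀ y ∈ Y₁, (1 + ε)⁻¹ * ‖y‖ ≤ ‖fg.2 y‖ ∧ ‖fg.2 y‖ ≤ ‖y‖) ∧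
  (∀ x ∈ X₁, ‖Ω (fg.1 x) - fg.2 (T x)‖ ≤ ε * ‖x‖)

lemma one_sub_le_aux (ε : ℝ) (hε : 0 < ε) : 1 - ε ≤ (1 + ε)⁻¹ := by
  rw [← one_div, le_div_iff₀ (by linarith)]
  nlinarith

lemma gurarii_step (Ω : U →L[ℝ] V) (hΩ : ‖Ω‖ ≤ 1) (hG : HasGurariiProperty Ω)
    (T : X →L[ℝ] Y) (hT : ‖T‖ ≤ 1)
    (X₁ X₂ : Submodule ℝ X) (Y₁ Y₂ : Submodule ℝ Y)
    [FiniteDimensional ℝ X₁] [FiniteDimensional ℝ X₂]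
    [FiniteDimensional ℝ Y₁] [FiniteDimensional ℝ Y₂]
    (hX : X₁ ≤ X₂) (hY : Y₁ ≤ Y₂)
    (hT1 : ∀ x ∈ X₁, T x ∈ Y₁) (hT2 : ∀ x ∈ X₂, T x ∈ Y₂)
    (ε : ℝ) (hε : 0 < ε) (hε1 : 2 * ε ≤ 1) (ε' : ℝ) (hε' : 0 < ε')
    (fg : (X →ₗ[ℝ] U) × (Y →ₗ[ℝ] V)) (h : IsApprox Ω T X₁ Y₁ ε fg) :
    ∃ fg' : (X →ₗ[ℝ] U) × (Y →ₗ[ℝ] V), IsApprox Ω T X₂ Y₂ ε' fg' ∧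
      (∀ x ∈ X₁, ‖fg'.1 x - fg.1 x‖ ≤ (2 * ε + ε') * ‖x‖) ∧
      (∀ y ∈ Y₁, ‖fg'.2 y - fg.2 y‖ ≤ (2 * ε + ε') * ‖y‖) := by
  obtain ⟨f, g⟩ := fg
  obtain ⟨hf, hg, hfg⟩ := h
  simp only at hf hg hfg
  have haux := one_sub_le_aux ε hε
  obtain ⟨p, hp, hp1, hp2, hp3, hp4⟩ := exists_amalgam f X₁ (2 * ε) (by positivity) hε1
    (fun w hw => ⟨(mul_le_mul_of_nonneg_right (by linarith) (norm_nonneg w)).trans (hf w hw).1,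
      (hf w hw).2⟩)
  obtain ⟨q, hq, hq1, hq2, hq3, hq4⟩ := exists_amalgam g Y₁ ε hε (by linarith)
    (fun w hw => ⟨(mul_le_mul_of_nonneg_right haux (norm_nonneg w)).trans (hg w hw).1,
      (hg w hw).2⟩)
  have hΩ' : ∀ u, ‖Ω u‖ ≤ ‖u‖ := fun u => by simpa using Ω.le_of_opNorm_le hΩ u
  have hT' : ∀ u, ‖T u‖ ≤ ‖u‖ := fun u => by simpa using T.le_of_opNorm_le hT u
  let S : U × X →ₗ[ℝ] V × Y := Ω.toLinearMap.prodMap T.toLinearMap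
  have hS : ∀ a x, S (a, x) = (Ω a, T x) := fun a x => rfl
  let A : Submodule ℝ U := X₁.map f
  let B : Submodule ℝ V := Y₁.map g ⊔ A.map Ω.toLinearMap
  have fd1 : FiniteDimensional ℝ (A.prod X₂) :=
    Module.Finite.iff_fg.mpr (Submodule.FG.prod (Module.Finite.iff_fg.mp inferInstance)
      (Module.Finite.iff_fg.mp inferInstance))
  have fd2 : FiniteDimensional ℝ (B.prod Y₂) :=
    Module.Finite.iff_fg.mpr (Submodule.FG.prod (Module.Finite.iff_fg.mp inferInstance)
      (Module.Finite.iff_fg.mp inferInstance))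
  obtain ⟨I, J, h1, h2, h3, h4, h5⟩ := gurarii_sub Ω hG p hp q hq S
    (by
      rintro ⟨a, x⟩
      rw [hS]
      refine hp4 _ _ _ fun w hw => (hq3 (Ω a) (T x) (T w) (hT1 w hw)).trans ?_
      have e1 : Ω a - g (T w) = Ω (a - f w) + (Ω (f w) - g (T w)) := by
        rw [map_sub]; abel
      have e2 := norm_add_le (Ω (a - f w)) (Ω (f w) - g (T w))
      rw [← e1] at e2
      have e3 := hΩ' (a - f w)
      have e4 := hfg w hw
      have e5 := hT' (x + w)
      rw [map_add] at e5
      have e6 := mul_le_mul_of_nonneg_left (hT' w) hε.le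
      linarith)
    (A.prod X₂) (B.prod Y₂)
    (by
      rintro ⟨a, x⟩ ⟨ha, hx⟩
      exact ⟨Submodule.mem_sup_right (Submodule.mem_map_of_mem ha), hT2 _ hx⟩)
    (A.prod ⊥) (B.prod ⊥)
    (by
      rintro ⟨a, x⟩ ⟨ha, hx⟩
      refine ⟨Submodule.mem_sup_right (Submodule.mem_map_of_mem ha), ?_⟩
      have hx : x = 0 := hx
      subst hx
      exact T.map_zero)
    (Submodule.prod_mono le_rfl bot_le) (Submodule.prod_mono le_rfl bot_le)
    (LinearMap.fst ℝ U X) (LinearMap.fst ℝ V Y)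
    (by
      rintro ⟨a, x⟩ ⟨ha, hx⟩
      have hx : x = 0 := hx
      subst hx
      exact (hp1 a).symm)
    (by
      rintro ⟨a, x⟩ ⟨ha, hx⟩
      have hx : x = 0 := hx
      subst hx
      exact (hq1 a).symm)
    (fun x _ => rfl) ε' hε'
  refine ⟨(I ∘ₗ LinearMap.inr ℝ U X, J ∘ₗ LinearMap.inr ℝ V Y), ⟨?_, ?_, ?_⟩, ?_, ?_⟩
  · intro x hx
    have := h1 (0, x) ⟨zero_mem _, hx⟩
    rw [hp2] at this
    exact this
  · intro x hx
    have := h2 (0, x) ⟨zero_mem _, hx⟩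
    rw [hq2] at this
    exact this
  · intro x hx
    have := h5 (0, x) ⟨zero_mem _, hx⟩
    rw [hp2, hS, map_zero] at this
    exact this
  · intro x hx
    change ‖I (0, x) - f x‖ ≤ _
    have hA : f x ∈ A := Submodule.mem_map_of_mem hx
    have e1 := h3 (f x, 0) ⟨hA, zero_mem _⟩
    rw [hp1] at e1
    change ‖I (f x, 0) - f x‖ ≤ _ at e1
    have e2 := (h1 (-f x, x) ⟨neg_mem hA, hX hx⟩).2
    have e3 := hp3 (-f x) x (-x) (neg_mem hx)
    have e4 : I (0, x) - f x = I (-f x, x) + (I (f x, 0) - f x) := by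
      rw [← add_sub_assoc, ← map_add]; simp
    rw [e4]
    have e5 := norm_add_le (I (-f x, x)) (I (f x, 0) - f x)
    have e6 := mul_le_mul_of_nonneg_left (hf x hx).2 hε'.le
    simp at e3
    linarith
  · intro x hx
    change ‖J (0, x) - g x‖ ≤ _
    have hB : g x ∈ B := Submodule.mem_sup_left (Submodule.mem_map_of_mem hx)
    have e1 := h4 (g x, 0) ⟨hB, zero_mem _⟩
    rw [hq1] at e1
    change ‖J (g x, 0) - g x‖ ≤ _ at e1
    have e2 := (h2 (-g x, x) ⟨neg_mem hB, hY hx⟩).2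
    have e3 := hq3 (-g x) x (-x) (neg_mem hx)
    have e4 : J (0, x) - g x = J (-g x, x) + (J (g x, 0) - g x) := by
      rw [← add_sub_assoc, ← map_add]; simp
    rw [e4]
    have e5 := norm_add_le (J (-g x, x)) (J (g x, 0) - g x)
    have e6 := mul_le_mul_of_nonneg_left (hg x hx).2 hε'.le
    have e7 : 0 ≤ ε * ‖x‖ := by positivity
    simp at e3
    linarith

/-- limit of a sequence of approximate isometries on an increasing chain of subspaces -/
lemma exists_limit_isometry [CompleteSpace U] (D : ℕ → Submodule ℝ X) (hD : Monotone D)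
    (hdense : Dense (⋃ n, (D n : Set X))) (f : ℕ → X →ₗ[ℝ] U) (ε : ℕ → ℝ)
    (hε : Tendsto ε atTop (𝓝 0))
    (hf : ∀ n, ∀ x ∈ D n, (1 + ε n)⁻¹ * ‖x‖ ≤ ‖f n x‖ ∧ ‖f n x‖ ≤ ‖x‖)
    (C : ℝ) (hd : ∀ n, ∀ x ∈ D n, ‖f (n + 1) x - f n x‖ ≤ C * (1 / 2) ^ n * ‖x‖) :
    ∃ i : X →ₗᵢ[ℝ] U, ∀ n, ∀ x ∈ D n, Tendsto (fun m => f m x) atTop (𝓝 (i x)) := by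
  have hmem : ∀ x, x ∈ (⨆ n, D n) ↔ ∃ n, x ∈ D n :=
    fun x => Submodule.mem_iSup_of_directed D hD.directed_le
  have hlim : ∀ x : (⨆ n, D n : Submodule ℝ X), ∃ u, Tendsto (fun m => f m x) atTop (𝓝 u) := by
    rintro ⟨x, hx⟩
    obtain ⟨n, hn⟩ := (hmem x).1 hx
    have hc : CauchySeq (fun m => f (m + n) x) := by
      refine cauchySeq_of_le_geometric (1 / 2) (C * (1 / 2) ^ n * ‖x‖) (by norm_num) fun m => ?_
      rw [dist_comm, dist_eq_norm]
      have := hd (m + n) x (hD (by omega) hn)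
      rw [show m + 1 + n = m + n + 1 by ring]
      refine this.trans (le_of_eq ?_)
      rw [pow_add]; ring
    obtain ⟨u, hu⟩ := cauchySeq_tendsto_of_complete hc
    exact ⟨u, (tendsto_add_atTop_iff_nat n).1 hu⟩
  choose F hF using hlim
  let L : (⨆ n, D n : Submodule ℝ X) →ₗ[ℝ] U :=
    { toFun := F
      map_add' := fun x y => by
        refine tendsto_nhds_unique (hF (x + y)) ?_
        simpa using (hF x).add (hF y)
      map_smul' := fun c x => by
        refine tendsto_nhds_unique (hF (c • x)) ?_
        simpa using (hF x).const_smul c }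
  have hL : ∀ x, ‖L x‖ = ‖x‖ := by
    intro x
    obtain ⟨n, hn⟩ := (hmem x).1 x.2
    have t1 : Tendsto (fun m => ‖f m x‖) atTop (𝓝 ‖L x‖) := (hF x).norm
    have t2 : Tendsto (fun m => (1 + ε m)⁻¹ * ‖(x : X)‖) atTop (𝓝 ((1 + 0)⁻¹ * ‖(x : X)‖)) :=
      (((tendsto_const_nhds.add hε).inv₀ (by norm_num)).mul_const _)
    have a1 := le_of_tendsto_of_tendsto t2 t1
      (by filter_upwards [eventually_ge_atTop n] with m hm using (hf m x (hD hm hn)).1)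
    have a2 := le_of_tendsto t1
      (by filter_upwards [eventually_ge_atTop n] with m hm using (hf m x (hD hm hn)).2)
    simp only [add_zero, inv_one, one_mul] at a1
    exact le_antisymm a2 a1
  let Li : (⨆ n, D n : Submodule ℝ X) →ₗᵢ[ℝ] U := ⟨L, hL⟩
  have hdr : DenseRange ((⨆ n, D n : Submodule ℝ X).subtypeL) := by
    have : Set.range ((⨆ n, D n : Submodule ℝ X).subtypeL) = ⋃ n, (D n : Set X) := by
      ext x
      simp [hmem]
    rw [DenseRange, this]
    exact hdense
  have hui : IsUniformInducing ((⨆ n, D n : Submodule ℝ X).subtypeL) :=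
    isUniformInducing_val _
  let G : X →L[ℝ] U := Li.toContinuousLinearMap.extend (⨆ n, D n : Submodule ℝ X).subtypeL
  have hGe : ∀ x : (⨆ n, D n : Submodule ℝ X), G x = L x := fun x =>
    ContinuousLinearMap.extend_eq _ hdr hui x
  refine ⟨⟨G.toLinearMap, fun x => ?_⟩, fun n x hx => ?_⟩
  · refine congrFun (DenseRange.equalizer hdr (g := fun x => ‖G x‖) (h := fun x => ‖x‖)
      (by fun_prop) (by fun_prop) ?_) x
    ext y
    change ‖G y‖ = ‖(y : X)‖
    rw [hGe, hL]; rfl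
  · have hxs : x ∈ (⨆ n, D n) := (hmem x).2 ⟨n, hx⟩
    change Tendsto _ _ (𝓝 (G x))
    rw [hGe ⟨x, hxs⟩]
    exact hF ⟨x, hxs⟩

end

/-- Universality: an operator with the Gurarii property between separable Banach spaces
captures every nonexpansive operator between separable Banach spaces. -/
theorem isometrically_universal_of_GurariiProperty
    {U V : Type*} [NormedAddCommGroup U] [NormedSpace ℝ U] [CompleteSpace U]
    [TopologicalSpace.SeparableSpace U]
    [NormedAddCommGroup V] [NormedSpace ℝ V] [CompleteSpace V]
    [TopologicalSpace.SeparableSpace V]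
    (Ω : U →L[ℝ] V) (hΩ : ‖Ω‖ ≤ 1) (hG : HasGurariiProperty Ω)
    {X Y : Type*} [NormedAddCommGroup X] [NormedSpace ℝ X] [CompleteSpace X]
    [TopologicalSpace.SeparableSpace X]
    [NormedAddCommGroup Y] [NormedSpace ℝ Y] [CompleteSpace Y]
    [TopologicalSpace.SeparableSpace Y]
    (T : X →L[ℝ] Y) (hT : ‖T‖ ≤ 1) :
    ∃ (i : X →ₗᵢ[ℝ] U) (j : Y →ₗᵢ[ℝ] V), ∀ x : X, Ω (i x) = j (T x) := by
  have hT' : ∀ u, ‖T u‖ ≤ ‖u‖ := fun u => by simpa using T.le_of_opNorm_le hT u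
  let xs := TopologicalSpace.denseSeq X
  let ys := TopologicalSpace.denseSeq Y
  let D : ℕ → Submodule ℝ X := fun n => Submodule.span ℝ (Set.image xs (Set.Iio n))
  let R : ℕ → Submodule ℝ Y := fun n =>
    Submodule.span ℝ (Set.image ys (Set.Iio n)) ⊔ (D n).map T.toLinearMap
  have hDm : Monotone D := fun m n h =>
    Submodule.span_mono (Set.image_mono (Set.Iio_subset_Iio h))
  have hRm : Monotone R := fun m n h =>
    sup_le_sup (Submodule.span_mono (Set.image_mono (Set.Iio_subset_Iio h)))
      (Submodule.map_mono (hDm h))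
  have hDf : ∀ n, FiniteDimensional ℝ (D n) := fun n =>
    FiniteDimensional.span_of_finite ℝ ((Set.finite_Iio n).image _)
  have hRf : ∀ n, FiniteDimensional ℝ (R n) := fun n => by
    have := hDf n
    have : FiniteDimensional ℝ (Submodule.span ℝ (Set.image ys (Set.Iio n))) :=
      FiniteDimensional.span_of_finite ℝ ((Set.finite_Iio n).image _)
    exact Submodule.finiteDimensional_sup _ _
  have hTD : ∀ n, ∀ x ∈ D n, T x ∈ R n := fun n x hx =>
    Submodule.mem_sup_right (Submodule.mem_map_of_mem hx)
  have hDd : Dense (⋃ n, (D n : Set X)) := by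
    refine (TopologicalSpace.denseRange_denseSeq X).mono ?_
    rintro _ ⟨n, rfl⟩
    exact Set.mem_iUnion.2 ⟨n + 1, Submodule.subset_span ⟨n, Nat.lt_succ_self n, rfl⟩⟩
  have hRd : Dense (⋃ n, (R n : Set Y)) := by
    refine (TopologicalSpace.denseRange_denseSeq Y).mono ?_
    rintro _ ⟨n, rfl⟩
    exact Set.mem_iUnion.2 ⟨n + 1, Submodule.mem_sup_left
      (Submodule.subset_span ⟨n, Nat.lt_succ_self n, rfl⟩)⟩
  let ε : ℕ → ℝ := fun n => (1 / 2) ^ (n + 1)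
  have hε0 : ∀ n, 0 < ε n := fun n => by positivity
  have hε1 : ∀ n, 2 * ε n ≤ 1 := fun n => by
    have : (1 / 2 : ℝ) ^ n ≤ 1 := pow_le_one₀ (by norm_num) (by norm_num)
    simp only [ε, pow_succ]; linarith
  have hεt : Tendsto ε atTop (𝓝 0) :=
    (tendsto_add_atTop_iff_nat 1).2 (tendsto_pow_atTop_nhds_zero_of_lt_one (by norm_num) (by norm_num))
  have hstep : ∀ n, ∀ fg : {fg // IsApprox Ω T (D n) (R n) (ε n) fg},
      ∃ fg' : {fg // IsApprox Ω T (D (n + 1)) (R (n + 1)) (ε (n + 1)) fg},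
      (∀ x ∈ D n, ‖fg'.1.1 x - fg.1.1 x‖ ≤ (2 * ε n + ε (n + 1)) * ‖x‖) ∧
      (∀ y ∈ R n, ‖fg'.1.2 y - fg.1.2 y‖ ≤ (2 * ε n + ε (n + 1)) * ‖y‖) := by
    rintro n ⟨fg, h⟩
    have := hDf n
    have := hDf (n + 1)
    have := hRf n
    have := hRf (n + 1)
    obtain ⟨fg', h1, h2⟩ := gurarii_step Ω hΩ hG T hT (D n) (D (n + 1)) (R n) (R (n + 1))
      (hDm (Nat.le_succ n)) (hRm (Nat.le_succ n)) (hTD n) (hTD (n + 1)) (ε n) (hε0 n) (hε1 n)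
      (ε (n + 1)) (hε0 _) fg h
    exact ⟨⟨fg', h1⟩, h2⟩
  choose step hst using hstep
  have hbase : IsApprox Ω T (D 0) (R 0) (ε 0) (0, 0) := by
    have hD0 : ∀ x ∈ D 0, x = 0 := fun x hx => by simpa [D] using hx
    have hR0 : ∀ x ∈ R 0, x = 0 := fun x hx => by simpa [D, R] using hx
    refine ⟨fun x hx => ?_, fun x hx => ?_, fun x hx => ?_⟩
    · simp [hD0 x hx]
    · simp [hR0 x hx]
    · simp [hD0 x hx]
  let s : ∀ n, {fg // IsApprox Ω T (D n) (R n) (ε n) fg} := fun n =>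
    Nat.rec ⟨(0, 0), hbase⟩ (fun n fg => step n fg) n
  have hs : ∀ n, s (n + 1) = step n (s n) := fun n => rfl
  have hC : ∀ n, 2 * ε n + ε (n + 1) ≤ 2 * (1 / 2) ^ n := fun n => by
    have : (0 : ℝ) < (1 / 2) ^ n := by positivity
    simp only [ε, pow_succ]; linarith
  obtain ⟨i, hi⟩ := exists_limit_isometry D hDm hDd (fun n => (s n).1.1) ε hεt
    (fun n => (s n).2.1) 2 (fun n x hx => by
      rw [hs]
      exact ((hst n (s n)).1 x hx).trans (mul_le_mul_of_nonneg_right (hC n) (norm_nonneg _)))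
  obtain ⟨j, hj⟩ := exists_limit_isometry R hRm hRd (fun n => (s n).1.2) ε hεt
    (fun n => (s n).2.2.1) 2 (fun n x hx => by
      rw [hs]
      exact ((hst n (s n)).2 x hx).trans (mul_le_mul_of_nonneg_right (hC n) (norm_nonneg _)))
  refine ⟨i, j, fun x => ?_⟩
  have hcl : IsClosed {x : X | Ω (i x) = j (T x)} :=
    isClosed_eq (Ω.continuous.comp i.continuous) (j.continuous.comp T.continuous)
  have hsub : (⋃ n, (D n : Set X)) ⊆ {x : X | Ω (i x) = j (T x)} := by
    intro x hx
    obtain ⟨n, hn⟩ := Set.mem_iUnion.1 hx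
    have t1 := ((Ω.continuous.tendsto _).comp (hi n x hn)).sub (hj n (T x) (hTD n x hn))
    have t2 : Tendsto (fun m => ε m * ‖x‖) atTop (𝓝 0) := by
      simpa using hεt.mul_const ‖x‖
    have t3 := squeeze_zero_norm' (by
      filter_upwards [eventually_ge_atTop n] with m hm
      exact (s m).2.2.2 x (hDm hm hn)) t2
    exact sub_eq_zero.1 (tendsto_nhds_unique t1 t3)
  exact hcl.closure_subset_iff.2 hsub (hDd x)
end
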